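/- Let y ∈ ℝ^L with y ≠ 0, s ∈ {−1,1}^L, B ∈ ℝ^{L×K} and C ∈ ℝ^{L×N} with ℓ-th rows bℓᵀ and cℓᵀ. Then the feasible set of the BranchHull program, namely {(h,m) ∈ ℝ^K × ℝ^N : sign(yℓ)·(bℓᵀh)·(cℓᵀm) ≥ |yℓ| and sℓ·(bℓᵀh) ≥ 0 for all ℓ = 1,…,L}, is a convex subset of ℝ^K × ℝ^N. -/

import Mathlib

/-- The region on or above one branch of a hyperbola is convex. -/
theorem convex_hyperbola_branch {c : ℝ} (hc : 0 < c) :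
    Convex ℝ {q : ℝ × ℝ | c ≤ q.1 * q.2 ∧ 0 ≤ q.1} := by
  rintro ⟨u, v⟩ ⟨h, hu⟩ ⟨u', v'⟩ ⟨h', hu'⟩ a b ha hb hab
  simp only at h hu h' hu'
  have hv : 0 < v := pos_of_mul_pos_right (hc.trans_le h) hu
  have hv' : 0 < v' := pos_of_mul_pos_right (hc.trans_le h') hu'
  have hcross : 2 * c ≤ u * v' + u' * v := by
    have hprod : c * c ≤ (u * v) * (u' * v') := mul_le_mul h h' hc.le (hc.le.trans h)
    have hnonneg : 0 ≤ u * v' + u' * v := by positivity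
    refine le_of_sq_le_sq ?_ hnonneg
    nlinarith [sq_nonneg (u * v' - u' * v)]
  refine ⟨?_, by simp only [Prod.smul_mk, Prod.mk_add_mk, smul_eq_mul]; positivity⟩
  simp only [Prod.smul_mk, Prod.mk_add_mk, smul_eq_mul]
  calc c = a ^ 2 * c + a * b * (2 * c) + b ^ 2 * c := by
        linear_combination (-(a + b) - 1) * c * hab
    _ ≤ a ^ 2 * (u * v) + a * b * (u * v' + u' * v) + b ^ 2 * (u' * v') := by gcongr
    _ = (a * u + b * u') * (a * v + b * v') := by ring

/-- The pairs with a prescribed product sign, a lower bound on the size of the product, and a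
prescribed sign of the first coordinate form a convex set. -/
theorem convex_sign_mul_ge {s : ℝ} (hs : s = 1 ∨ s = -1) (y : ℝ) :
    Convex ℝ {q : ℝ × ℝ | Real.sign y * (q.1 * q.2) ≥ |y| ∧ s * q.1 ≥ 0} := by
  have hss : s * s = 1 := by rcases hs with rfl | rfl <;> norm_num
  by_cases hy : y = 0
  · subst hy
    simpa using convex_halfSpace_ge (s • LinearMap.fst ℝ ℝ ℝ).isLinear 0
  · have hset : {q : ℝ × ℝ | Real.sign y * (q.1 * q.2) ≥ |y| ∧ s * q.1 ≥ 0} =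
        (s • LinearMap.fst ℝ ℝ ℝ).prod ((Real.sign y * s) • LinearMap.snd ℝ ℝ ℝ) ⁻¹'
          {q | |y| ≤ q.1 * q.2 ∧ 0 ≤ q.1} := by
      ext q
      have hmul : (s * q.1) * (Real.sign y * s * q.2) = Real.sign y * (q.1 * q.2) := by
        linear_combination Real.sign y * q.1 * q.2 * hss
      simp [hmul]
    rw [hset]
    exact (convex_hyperbola_branch (abs_pos.mpr hy)).linear_preimage _

/-- The feasible set of the BranchHull program is convex. -/
theorem stmt2 {L K N : ℕ} (B : Fin L → Fin K → ℝ) (C : Fin L → Fin N → ℝ)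
    (y s : Fin L → ℝ) (hy : y ≠ 0) (hs : ∀ ℓ, s ℓ = 1 ∨ s ℓ = -1) :
    Convex ℝ {p : EuclideanSpace ℝ (Fin K) × EuclideanSpace ℝ (Fin N) |
      ∀ ℓ, Real.sign (y ℓ) * ((∑ i, B ℓ i * p.1 i) * (∑ j, C ℓ j * p.2 j)) ≥ |y ℓ| ∧
        s ℓ * (∑ i, B ℓ i * p.1 i) ≥ 0} := by
  rw [Set.ofPred_forall]
  refine convex_iInter fun ℓ => ?_
  refine (convex_sign_mul_ge (hs ℓ) (y ℓ)).is_linear_preimage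
    (f := fun p : EuclideanSpace ℝ (Fin K) × EuclideanSpace ℝ (Fin N) =>
      (∑ i, B ℓ i * p.1 i, ∑ j, C ℓ j * p.2 j)) ⟨fun p q => ?_, fun a p => ?_⟩
  · simp [mul_add, Finset.sum_add_distrib]
  · simp [Finset.mul_sum, mul_left_comm]
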